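/- For any prior distribution q on {0,1}^N and any deterministic local strategy for the GYNI game, the winning probability ∑_x q(x)·[strategy wins on x] is at most max over x of (q(x) + q(x̄)). Combined with the lower bound, the optimal classical deterministic winning probability is exactly ω_c = max_x (q(x) + q(x̄)). -/

import Mathlib

open scoped BigOperators

/-- Bitwise negation of a bit string. -/
def negStr {N : ℕ} (x : Fin N → Bool) : Fin N → Bool := fun i => !(x i)

/-- A no-signalling box for `N` parties with binary inputs and outputs. -/
structure NSBox (N : ℕ) where
  P : (Fin N → Bool) → (Fin N → Bool) → ℝ
  nonneg : ∀ a x, 0 ≤ P a x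
  normalized : ∀ x, ∑ a, P a x = 1
  noSignalling : ∀ (S : Finset (Fin N)) (x x' : Fin N → Bool),
    (∀ i ∈ S, x i = x' i) → ∀ a : Fin N → Bool,
      ∑ a' ∈ Finset.univ.filter (fun a' => ∀ i ∈ S, a' i = a i), P a' x =
      ∑ a' ∈ Finset.univ.filter (fun a' => ∀ i ∈ S, a' i = a i), P a' x'

/-- GYNI winning probability of a no-signalling box for prior `q`. -/
noncomputable def gyniWin {N : ℕ} [NeZero N] (q : (Fin N → Bool) → ℝ) (B : NSBox N) : ℝ :=
  ∑ x, q x * B.P (fun i => x (i + 1)) x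

/-- The classical GYNI bound `ω_c = max_x (q(x) + q(x̄))`. -/
noncomputable def omegaC {N : ℕ} (q : (Fin N → Bool) → ℝ) : ℝ :=
  Finset.univ.sup' Finset.univ_nonempty (fun x => q x + q (negStr x))

/-- A deterministic local strategy wins the GYNI game on input string `x`. -/
def winsOn {N : ℕ} [NeZero N] (f : Fin N → Bool → Bool) (x : Fin N → Bool) : Bool :=
  decide (∀ i, f i (x i) = x (i + 1))

/-- Winning probability of a deterministic local strategy. -/
noncomputable def classWin {N : ℕ} [NeZero N] (q : (Fin N → Bool) → ℝ)
    (f : Fin N → Bool → Bool) : ℝ :=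
  ∑ x, q x * (if winsOn f x then (1:ℝ) else 0)

theorem gyni_step {N : ℕ} [NeZero N] (m : ℕ) : Fin.ofNat N (m+1) = Fin.ofNat N m + 1 := by
  ext
  simp [Fin.val_add]

theorem gyni_prop {N : ℕ} [NeZero N] (f : Fin N → Bool → Bool) (x y : Fin N → Bool)
    (hx : ∀ i, f i (x i) = x (i + 1)) (hy : ∀ i, f i (y i) = y (i + 1))
    (i : Fin N) (hi : x i = y i) : x = y := by
  have key : ∀ k : ℕ, x (Fin.ofNat N (i.val + k)) = y (Fin.ofNat N (i.val + k)) := by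
    intro k
    induction k with
    | zero => simpa using hi
    | succ k ih =>
      rw [← add_assoc, gyni_step, ← hx, ← hy, ih]
  funext j
  have h := key (j.val + N - i.val)
  have e : Fin.ofNat N (i.val + (j.val + N - i.val)) = j := by
    ext
    have := i.isLt
    have h2 : i.val + (j.val + N - i.val) = j.val + N := by omega
    rw [h2]
    simp [Nat.mod_eq_of_lt j.isLt]
  rwa [e] at h

theorem gyni_neg {N : ℕ} [NeZero N] (f : Fin N → Bool → Bool) (x y : Fin N → Bool)
    (hx : ∀ i, f i (x i) = x (i + 1)) (hy : ∀ i, f i (y i) = y (i + 1)) :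
    y = x ∨ y = negStr x := by
  by_cases h : ∃ i, x i = y i
  · obtain ⟨i, hi⟩ := h
    exact Or.inl (gyni_prop f x y hx hy i hi).symm
  · right
    funext i
    have : x i ≠ y i := fun e => h ⟨i, e⟩
    unfold negStr
    revert this
    cases x i <;> cases y i <;> simp

theorem gyni_ne {N : ℕ} [NeZero N] (x : Fin N → Bool) : x ≠ negStr x := by
  intro h
  have := congrFun h 0
  simp [negStr] at this

theorem gyni_classWin_eq {N : ℕ} [NeZero N] (q : (Fin N → Bool) → ℝ)
    (f : Fin N → Bool → Bool) :
    classWin q f = ∑ x ∈ Finset.univ.filter (fun x => winsOn f x = true), q x := by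
  simp [classWin, Finset.sum_filter]

theorem gyni_upper {N : ℕ} [NeZero N] (q : (Fin N → Bool) → ℝ) (hq : ∀ x, 0 ≤ q x)
    (f : Fin N → Bool → Bool) : classWin q f ≤ omegaC q := by
  have hle : ∀ x, q x + q (negStr x) ≤ omegaC q := fun x =>
    Finset.le_sup' (fun x => q x + q (negStr x)) (Finset.mem_univ x)
  rw [gyni_classWin_eq]
  by_cases h : ∃ x, winsOn f x = true
  · obtain ⟨x, hx⟩ := h
    refine le_trans ?_ (hle x)
    rw [← Finset.sum_pair (gyni_ne x)]
    apply Finset.sum_le_sum_of_subset_of_nonneg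
    · intro y hy
      have hy' := (Finset.mem_filter.mp hy).2
      simp only [winsOn, decide_eq_true_eq] at hx hy'
      simpa using gyni_neg f x y hx hy'
    · intro y _ _
      exact hq y
  · rw [Finset.filter_false_of_mem (fun x _ hx => h ⟨x, hx⟩), Finset.sum_empty]
    exact le_trans (add_nonneg (hq _) (hq _)) (hle (fun _ => false))

theorem gyni_attain {N : ℕ} [NeZero N] (q : (Fin N → Bool) → ℝ) (hq : ∀ x, 0 ≤ q x) :
    ∃ f : Fin N → Bool → Bool, omegaC q ≤ classWin q f := by
  obtain ⟨x, -, hx⟩ := Finset.exists_mem_eq_sup' (s := Finset.univ) Finset.univ_nonempty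
    (fun x : Fin N → Bool => q x + q (negStr x))
  refine ⟨fun i b => if b = x i then x (i+1) else !x (i+1), ?_⟩
  rw [gyni_classWin_eq]
  unfold omegaC
  rw [hx, ← Finset.sum_pair (gyni_ne x)]
  apply Finset.sum_le_sum_of_subset_of_nonneg
  · intro y hy
    rw [Finset.mem_insert, Finset.mem_singleton] at hy
    rcases hy with rfl | rfl <;> simp [winsOn, negStr]
  · intro y _ _
    exact hq y

/-- Every deterministic local strategy has GYNI winning probability at most
`ω_c = max_x (q x + q x̄)`, and `ω_c` is exactly the optimal classical
deterministic winning probability. -/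
theorem gyni_classical_optimum {N : ℕ} [NeZero N] (hN : 2 ≤ N)
    (q : (Fin N → Bool) → ℝ) (hq : ∀ x, 0 ≤ q x) (hsum : ∑ x, q x = 1) :
    (∀ f : Fin N → Bool → Bool, classWin q f ≤ omegaC q) ∧
      IsGreatest {w : ℝ | ∃ f : Fin N → Bool → Bool, w = classWin q f} (omegaC q) := by
  refine ⟨gyni_upper q hq, ?_, ?_⟩
  · obtain ⟨f, hf⟩ := gyni_attain q hq
    exact ⟨f, le_antisymm hf (gyni_upper q hq f)⟩
  · rintro w ⟨f, rfl⟩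
    exact gyni_upper q hq f
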